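/- arXiv:math/0701423 — 4 statements merged into one kernel-verified Lean document; each statement's English description precedes it below -/
import Mathlib

section
/- Let n ≥ 1, let H be an n×n complex matrix and let b ∈ ℂ^n be a nonzero vector. Form the (n+1)×(n+1) bordered matrix B whose upper-left n×n block is H, whose last column (above the corner) is b, whose last row (before the corner) is bᵀ, and whose bottom-right entry is 0. Then det B = 0 if and only if there exist a nonzero vector v ∈ ℂ^n and a scalar λ ∈ ℂ such that H·v = λ·b and b·v = 0 (dot product). -/
open Matrix

/-- The kernel of a bordered matrix, in coordinates. -/
theorem fromBlocks_border_mulVec_eq_zero_iff {ι R : Type*} [Fintype ι] [CommRing R]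
    (H : Matrix ι ι R) (b : ι → R) (x : ι ⊕ Fin 1 → R) :
    Matrix.fromBlocks H (Matrix.of fun i _ => b i) (Matrix.of fun (_ : Fin 1) j => b j) 0 *ᵥ x = 0 ↔
      H *ᵥ (x ∘ Sum.inl) = (-x (Sum.inr 0)) • b ∧ b ⬝ᵥ (x ∘ Sum.inl) = 0 := by
  have border_mulVec : (Matrix.of fun i (_ : Fin 1) => b i) *ᵥ (x ∘ Sum.inr) =
      x (Sum.inr 0) • b := by
    ext i
    simp [mulVec, dotProduct, mul_comm]
  rw [fromBlocks_mulVec, border_mulVec, zero_mulVec, add_zero, neg_smul, ← add_eq_zero_iff_eq_neg,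
    ← Sum.elim_zero_zero, Sum.elim_eq_iff]
  refine and_congr_right fun _ => ⟨fun h => congrFun h 0, fun h => funext fun _ => h⟩

/-- For `n ≥ 1`, an `n×n` complex matrix `H` and a nonzero vector `b ∈ ℂⁿ`,
the bordered matrix `B = fromBlocks H b bᵀ 0` has vanishing determinant if and only if
there is a nonzero vector `v` and a scalar `λ` with `H·v = λ·b` and `b·v = 0`. -/
theorem bordered_det_eq_zero_iff (n : ℕ) (hn : 1 ≤ n)
    (H : Matrix (Fin n) (Fin n) ℂ) (b : Fin n → ℂ) (hb : b ≠ 0)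
    (B : Matrix (Fin n ⊕ Fin 1) (Fin n ⊕ Fin 1) ℂ)
    (hB : B = Matrix.fromBlocks H (Matrix.of fun i _ => b i) (Matrix.of fun _ j => b j) 0) :
    B.det = 0 ↔ ∃ (v : Fin n → ℂ) (lam : ℂ), v ≠ 0 ∧ H.mulVec v = lam • b ∧ b ⬝ᵥ v = 0 := by
  subst hB
  rw [← exists_mulVec_eq_zero_iff]
  simp only [fromBlocks_border_mulVec_eq_zero_iff]
  constructor
  · rintro ⟨x, hx, hH, hdot⟩
    refine ⟨x ∘ Sum.inl, -x (Sum.inr 0), fun hv => hx ?_, hH, hdot⟩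
    rw [hv, mulVec_zero, eq_comm, smul_eq_zero, neg_eq_zero] at hH
    have hcorner : x (Sum.inr 0) = 0 := hH.resolve_right hb
    ext (i | j)
    · exact congrFun hv i
    · rwa [Subsingleton.elim j 0]
  · rintro ⟨v, lam, hv, hH, hdot⟩
    refine ⟨Sum.elim v fun _ => -lam, fun hx => hv ?_, ?_, ?_⟩
    · exact funext fun i => congrFun hx (Sum.inl i)
    · simpa using hH
    · simpa using hdot
end

section
/- Let n ≥ 1, let H be an n×n complex matrix and let b ∈ ℂ^n be a nonzero vector. Then b · (adj(H)·b) = 0 if and only if there exist a nonzero vector v ∈ ℂ^n and a scalar λ ∈ ℂ such that H·v = λ·b and b·v = 0. -/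
open Matrix

namespace Matrix

variable {m R : Type*} [Fintype m] [DecidableEq m] [CommRing R]

theorem det_fromBlocks_replicateCol_replicateRow_zero_of_isLeftRegular (A : Matrix m m R)
    (u v : m → R) (hA : IsLeftRegular A.det) :
    (fromBlocks A (replicateCol Unit u) (replicateRow Unit v) 0).det =
      -(v ⬝ᵥ A.adjugate *ᵥ u) := by
  have hmul : fromBlocks A (replicateCol Unit u) (replicateRow Unit v) 0 *
      fromBlocks 1 (replicateCol Unit (-(A.adjugate *ᵥ u))) 0 (A.det • (1 : Matrix Unit Unit R)) =
      fromBlocks A 0 (replicateRow Unit v) (of fun _ _ => -(v ⬝ᵥ A.adjugate *ᵥ u)) := by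
    rw [fromBlocks_multiply]
    congr 1
    · simp
    · rw [← replicateCol_mulVec, mulVec_neg, mulVec_mulVec, mul_adjugate]
      ext i j
      simp [smul_mulVec]
    · simp
    · ext i j
      simp
  have hdet := congrArg det hmul
  rw [det_mul, det_fromBlocks_zero₂₁, det_fromBlocks_zero₁₂] at hdet
  apply hA
  simpa [mul_comm] using hdet

/-- The determinant of a square matrix bordered by a column, a row and a zero corner. -/
theorem det_fromBlocks_replicateCol_replicateRow_zero (A : Matrix m m R) (u v : m → R) :
    (fromBlocks A (replicateCol Unit u) (replicateRow Unit v) 0).det =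
      -(v ⬝ᵥ A.adjugate *ᵥ u) := by
  let B : Matrix m m (Polynomial R) := (Polynomial.X : Polynomial R) • 1 + A.map Polynomial.C
  let f : Polynomial R →+* R := Polynomial.evalRingHom 0
  have hB : f.mapMatrix B = A := by
    ext
    simp [f, B]
  have hreg : IsLeftRegular B.det :=
    (Polynomial.Monic.isRegular (Polynomial.leadingCoeff_det_X_one_add_C A)).left
  have hu : ∀ w : m → R, f ∘ (fun i => Polynomial.C (w i)) = w := fun w => by
    ext
    simp [f]
  have h := congrArg f (det_fromBlocks_replicateCol_replicateRow_zero_of_isLeftRegular B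
    (fun i => Polynomial.C (u i)) (fun i => Polynomial.C (v i)) hreg)
  have hadj : B.adjugate.map f = A.adjugate := by
    rw [← RingHom.mapMatrix_apply, RingHom.map_adjugate, hB]
  have hmap : f.mapMatrix (fromBlocks B (replicateCol Unit fun i => Polynomial.C (u i))
      (replicateRow Unit fun i => Polynomial.C (v i)) 0) =
      fromBlocks A (replicateCol Unit u) (replicateRow Unit v) 0 := by
    rw [RingHom.mapMatrix_apply, fromBlocks_map, ← RingHom.mapMatrix_apply, hB]
    congr 1 <;> ext <;> simp [f]
  have hmulVec : f ∘ (B.adjugate *ᵥ fun i => Polynomial.C (u i)) = A.adjugate *ᵥ u := by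
    ext i
    rw [Function.comp_apply, RingHom.map_mulVec, hadj, hu]
  rwa [RingHom.map_det, hmap, map_neg, RingHom.map_dotProduct, hu, hmulVec] at h

end Matrix

/-- For `n ≥ 1`, an `n×n` complex matrix `H` and a nonzero vector `b ∈ ℂⁿ`,
one has `b · (adj(H)·b) = 0` if and only if there exist a nonzero vector `v` and a scalar
`λ` with `H·v = λ·b` and `b·v = 0`. -/
theorem dot_adjugate_eq_zero_iff (n : ℕ) (hn : 1 ≤ n)
    (H : Matrix (Fin n) (Fin n) ℂ) (b : Fin n → ℂ) (hb : b ≠ 0) :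
    b ⬝ᵥ H.adjugate.mulVec b = 0 ↔
      ∃ (v : Fin n → ℂ) (lam : ℂ), v ≠ 0 ∧ H.mulVec v = lam • b ∧ b ⬝ᵥ v = 0 := by
  have hker : ∀ (v : Fin n → ℂ) (c : ℂ),
      fromBlocks H (replicateCol Unit b) (replicateRow Unit b) 0 *ᵥ Sum.elim v (fun _ => c) = 0 ↔
        H *ᵥ v = (-c) • b ∧ b ⬝ᵥ v = 0 := by
    intro v c
    have hcol : replicateCol Unit b *ᵥ (fun _ => c) = c • b := by
      ext i
      simp [mulVec, dotProduct, mul_comm]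
    have hrow : replicateRow Unit b *ᵥ v = fun _ => b ⬝ᵥ v := rfl
    rw [fromBlocks_mulVec, Sum.elim_comp_inl, Sum.elim_comp_inr, hcol, hrow, zero_mulVec, add_zero,
      ← Sum.elim_zero_zero, Sum.elim_eq_iff, neg_smul, eq_neg_iff_add_eq_zero]
    simp [funext_iff]
  rw [← neg_eq_zero, ← det_fromBlocks_replicateCol_replicateRow_zero, ← exists_mulVec_eq_zero_iff]
  constructor
  · rintro ⟨w, hw, h⟩
    have hw_elim : w = Sum.elim (w ∘ Sum.inl) (fun _ => w (Sum.inr ())) :=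
      (Sum.elim_comp_inl_inr w).symm
    rw [hw_elim, hker] at h
    refine ⟨w ∘ Sum.inl, -w (Sum.inr ()), fun hv => hw ?_, h⟩
    have hc : w (Sum.inr ()) = 0 := by
      simpa [hv, hb, eq_comm] using h.1
    rw [hw_elim, hv, hc]
    exact Sum.elim_zero_zero
  · rintro ⟨v, c, hv, h⟩
    refine ⟨Sum.elim v (fun _ => -c), fun hw => hv ?_, (hker v (-c)).2 (by simpa using h)⟩
    simpa using congrArg (· ∘ Sum.inl) hw
end

section
/- Let g ≥ 1 and let τ be a complex g×g matrix whose imaginary part is positive definite (as a real symmetric matrix). Then for every z ∈ ℂ^g and all ε, δ ∈ ℤ^g, the family m ↦ exp(πi·((m+ε/2)·(τ(m+ε/2)) + 2(m+ε/2)·(z+δ/2))), indexed by m ∈ ℤ^g (i.e. m : Fin g → ℤ), is summable; in particular the theta series with characteristic [ε,δ] converges absolutely. -/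
open Matrix Complex

/-- The general term of the theta series with characteristic `[ε,δ]`:
`m ↦ exp(πi·((m+ε/2)·(τ(m+ε/2)) + 2(m+ε/2)·(z+δ/2)))` for `m : Fin g → ℤ`. -/
noncomputable def thetaTerm (g : ℕ) (ε δ : Fin g → ℤ) (τ : Matrix (Fin g) (Fin g) ℂ)
    (z : Fin g → ℂ) (m : Fin g → ℤ) : ℂ :=
  Complex.exp ((Real.pi : ℂ) * Complex.I *
    ((fun i => (m i : ℂ) + (ε i : ℂ) / 2) ⬝ᵥ (τ *ᵥ fun i => (m i : ℂ) + (ε i : ℂ) / 2)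
      + 2 * ((fun i => (m i : ℂ) + (ε i : ℂ) / 2) ⬝ᵥ fun i => z i + (δ i : ℂ) / 2)))

/-- A product of nonnegative summable families in separate variables is summable. -/
theorem summable_fin_prod {α : Type*} {n : ℕ} {f : Fin n → α → ℝ}
    (hf : ∀ i, Summable (f i)) (hf' : ∀ i a, 0 ≤ f i a) :
    Summable fun m : Fin n → α => ∏ i, f i (m i) := by
  induction n with
  | zero => exact Summable.of_finite
  | succ n ih =>
    rw [← (Fin.consEquiv fun _ => α).summable_iff]
    have hprod := (hf 0).mul_of_nonneg (ih (fun i => hf i.succ) fun i => hf' i.succ)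
      (hf' 0) fun m => Finset.prod_nonneg fun i _ => hf' i.succ (m i)
    refine hprod.congr fun m => ?_
    simp [Fin.consEquiv, Fin.prod_univ_succ]

/-- The quadratic form of a real positive definite matrix dominates a positive multiple of the
sum of squares. -/
theorem Matrix.PosDef.exists_pos_mul_dotProduct_le {ι : Type*} [Fintype ι] {A : Matrix ι ι ℝ}
    (hA : A.PosDef) : ∃ c > 0, ∀ v : ι → ℝ, c * (v ⬝ᵥ v) ≤ v ⬝ᵥ (A *ᵥ v) := by
  obtain ⟨c, hc, hle⟩ := (isCompact_sphere (0 : EuclideanSpace ℝ ι) 1).exists_forall_le'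
    (f := fun x => x.ofLp ⬝ᵥ (A *ᵥ x.ofLp)) (a := 0)
    (by unfold dotProduct mulVec dotProduct; fun_prop)
    (fun x hx => by
      have hx0 : x.ofLp ≠ 0 := fun h => by
        rw [WithLp.ofLp_eq_zero] at h
        simp [h] at hx
      simpa using hA.dotProduct_mulVec_pos hx0)
  refine ⟨c, hc, fun v => ?_⟩
  rcases eq_or_ne v 0 with rfl | hv
  · simp
  set x : EuclideanSpace ℝ ι := WithLp.toLp 2 v
  have hx : x ≠ 0 := by simpa [x] using hv
  have hnorm : ‖x‖ ^ 2 = v ⬝ᵥ v := by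
    rw [EuclideanSpace.real_norm_sq_eq]
    simp [dotProduct, x, sq]
  have hpos : 0 < ‖x‖ := norm_pos_iff.mpr hx
  have key := hle (‖x‖⁻¹ • x) (by simp [norm_smul, hpos.ne'])
  simp only [WithLp.ofLp_smul, x, mulVec_smul, smul_dotProduct, dotProduct_smul,
    smul_eq_mul] at key
  rw [← hnorm]
  field_simp at key
  exact (le_div_iff₀ (pow_pos hpos 2)).mp key

/-- A one-dimensional Gaussian series over a translate of the integers converges. -/
theorem summable_exp_neg_sq_shift {c : ℝ} (hc : 0 < c) (e y : ℝ) :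
    Summable fun m : ℤ => Real.exp (-Real.pi * (c * (m + e) ^ 2 + 2 * ((m + e) * y))) := by
  have h := ((summable_jacobiTheta₂_term_iff (((c * e + y : ℝ) : ℂ) * I) ((c : ℂ) * I)).mpr
    (by simpa using hc)).norm
  refine (h.mul_left (Real.exp (-Real.pi * (c * e ^ 2 + 2 * (e * y))))).congr fun m => ?_
  rw [norm_jacobiTheta₂_term, ← Real.exp_add, im_ofReal_mul, im_ofReal_mul, I_im]
  ring_nf

theorem norm_thetaTerm (g : ℕ) (ε δ : Fin g → ℤ) (τ : Matrix (Fin g) (Fin g) ℂ)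
    (z : Fin g → ℂ) (m : Fin g → ℤ) :
    ‖thetaTerm g ε δ τ z m‖ = Real.exp (-Real.pi *
      ((fun i => (m i : ℝ) + (ε i : ℝ) / 2) ⬝ᵥ
          ((Matrix.of fun i j => (τ i j).im) *ᵥ fun i => (m i : ℝ) + (ε i : ℝ) / 2)
        + 2 * ((fun i => (m i : ℝ) + (ε i : ℝ) / 2) ⬝ᵥ fun i => (z i).im))) := by
  have hcast (i : Fin g) : (m i : ℂ) + (ε i : ℂ) / 2 = ((m i + ε i / 2 : ℝ) : ℂ) := by
    push_cast; rfl
  have hδ (i : Fin g) : (δ i : ℂ) / 2 = ((δ i / 2 : ℝ) : ℂ) := by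
    push_cast; rfl
  have h_two (w : ℂ) : (2 * w).im = 2 * w.im := by simp
  rw [thetaTerm, Complex.norm_exp, mul_assoc, re_ofReal_mul, I_mul_re, neg_mul, mul_neg]
  simp only [hcast, hδ, dotProduct, mulVec, Matrix.of_apply, add_im, im_sum, im_ofReal_mul,
    im_mul_ofReal, ofReal_im, add_zero, h_two]

/-- If `g ≥ 1` and `τ` is a complex `g×g` matrix whose imaginary part is
positive definite, then for every `z ∈ ℂ^g` and all `ε, δ ∈ ℤ^g` the theta series with
characteristic `[ε,δ]` is (absolutely) summable. -/
theorem thetaTerm_summable (g : ℕ) (hg : 1 ≤ g) (τ : Matrix (Fin g) (Fin g) ℂ)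
    (hτ : (Matrix.of fun i j => (τ i j).im : Matrix (Fin g) (Fin g) ℝ).PosDef)
    (z : Fin g → ℂ) (ε δ : Fin g → ℤ) :
    Summable (thetaTerm g ε δ τ z) := by
  obtain ⟨c, hc, hle⟩ := hτ.exists_pos_mul_dotProduct_le
  refine Summable.of_norm_bounded (summable_fin_prod
    (fun i => summable_exp_neg_sq_shift hc ((ε i : ℝ) / 2) (z i).im)
    fun i m => (Real.exp_pos _).le) fun m => ?_
  rw [norm_thetaTerm, ← Real.exp_sum, Real.exp_le_exp, ← Finset.mul_sum, neg_mul, neg_mul,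
    neg_le_neg_iff]
  refine mul_le_mul_of_nonneg_left ?_ Real.pi_pos.le
  rw [Finset.sum_add_distrib, ← Finset.mul_sum, ← Finset.mul_sum]
  simpa [dotProduct, sq] using hle fun i => (m i : ℝ) + (ε i : ℝ) / 2
end

section
/- Let g ≥ 1, let τ be a symmetric complex g×g matrix and let ε, δ ∈ ℤ^g with ε·δ odd. Then the theta constant vanishes: θ[ε,δ](τ, 0) = 0. -/
open Matrix Complex

/-- The theta function with characteristic `[ε,δ]`:
`θ[ε,δ](τ,z) = ∑_{m ∈ ℤ^g} exp(πi·((m+ε/2)·(τ(m+ε/2)) + 2(m+ε/2)·(z+δ/2)))`. -/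
noncomputable def thetaChar (g : ℕ) (ε δ : Fin g → ℤ) (τ : Matrix (Fin g) (Fin g) ℂ)
    (z : Fin g → ℂ) : ℂ :=
  ∑' m : Fin g → ℤ, thetaTerm g ε δ τ z m

/-- The reflection `m ↦ -ε - m` changes the sign of the terms of an odd theta constant. -/
theorem thetaTerm_zero_reflect {g : ℕ} (τ : Matrix (Fin g) (Fin g) ℂ) {ε δ : Fin g → ℤ}
    (hodd : Odd (ε ⬝ᵥ δ)) (m : Fin g → ℤ) :
    thetaTerm g ε δ τ 0 (-ε - m) = -thetaTerm g ε δ τ 0 m := by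
  obtain ⟨k, hk⟩ := hodd
  set x : Fin g → ℂ := fun i => (m i : ℂ) + (ε i : ℂ) / 2 with hx
  set d : Fin g → ℂ := fun i => (0 : Fin g → ℂ) i + (δ i : ℂ) / 2 with hd
  have hneg : (fun i => (((-ε - m) i : ℤ) : ℂ) + (ε i : ℂ) / 2) = -x := by
    funext i
    simp only [hx, Pi.sub_apply, Pi.neg_apply]
    push_cast
    ring
  have hpair : 4 * (x ⬝ᵥ d) = 2 * ((m ⬝ᵥ δ : ℤ) : ℂ) + ((ε ⬝ᵥ δ : ℤ) : ℂ) := by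
    simp only [hx, hd, dotProduct, Int.cast_sum, Int.cast_mul, Finset.mul_sum,
      ← Finset.sum_add_distrib, Pi.zero_apply]
    exact Finset.sum_congr rfl fun i _ => by ring
  rw [hk] at hpair
  push_cast at hpair
  unfold thetaTerm
  rw [hneg, ← hx, ← hd, mulVec_neg, neg_dotProduct_neg, neg_dotProduct,
    ← exp_add_pi_mul_I, exp_eq_exp_iff_exists_int]
  refine ⟨-(m ⬝ᵥ δ) - k - 1, ?_⟩
  push_cast
  linear_combination (-(Real.pi : ℂ) * I) * hpair

/-- For `τ` symmetric and `[ε,δ]` an odd characteristic (`ε·δ` odd), the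
theta constant vanishes: `θ[ε,δ](τ, 0) = 0`. -/
theorem thetaChar_odd_vanishes (g : ℕ) (hg : 1 ≤ g) (τ : Matrix (Fin g) (Fin g) ℂ)
    (hτ : τ.IsSymm) (ε δ : Fin g → ℤ) (hodd : Odd (ε ⬝ᵥ δ)) :
    thetaChar g ε δ τ 0 = 0 := by
  have h : thetaChar g ε δ τ 0 = -thetaChar g ε δ τ 0 := by
    unfold thetaChar
    rw [← tsum_neg, ← (Equiv.subLeft (-ε)).tsum_eq]
    exact tsum_congr fun m => thetaTerm_zero_reflect τ hodd m
  exact self_eq_neg.mp h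
end
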